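/- Let X be an Archimedean lattice-ordered algebra with multiplicative identity 1_X, let n ∈ ℕ and let x₁, …, xₙ ∈ X. If Ψ₁, Ψ₂ : PG_n → X are lattice-algebra homomorphisms with Ψⱼ(𝟙) = 1_X and Ψⱼ(πᵢ) = xᵢ for i = 1, …, n and j = 1, 2, then Ψ₁ = Ψ₂. In other words, there is at most one lattice-algebra homomorphism PG_n → X sending 𝟙 to 1_X and πᵢ to xᵢ for i = 1, …, n. -/

import Mathlib

open scoped BigOperators

/-- A continuous function `ℝⁿ → ℝ` of polynomial growth (an element of `PG_n`). -/
def PolyGrowth (n : ℕ) (f : (Fin n → ℝ) → ℝ) : Prop :=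
  Continuous f ∧ ∃ (M : ℝ) (N : ℕ), 0 ≤ M ∧
    ∀ t : Fin n → ℝ, |f t| ≤ M * (1 + ∑ i : Fin n, |t i|) ^ N

/-- An element of `PG_n^h`: a polynomial growth continuous function `f` such that
`f (t • x) / t` converges as `t → 0⁺`, uniformly in `x` on every bounded set. -/
def PolyGrowthH (n : ℕ) (f : (Fin n → ℝ) → ℝ) : Prop :=
  PolyGrowth n f ∧ ∃ fh : (Fin n → ℝ) → ℝ,
    ∀ B : Set (Fin n → ℝ), Bornology.IsBounded B →
      ∀ ε : ℝ, 0 < ε → ∃ δ : ℝ, 0 < δ ∧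
        ∀ t : ℝ, 0 < t → t < δ → ∀ y ∈ B, |f (t • y) / t - fh y| < ε

/-- An element of `H_n`: a continuous positively homogeneous function `ℝⁿ → ℝ`. -/
def PosHomog (n : ℕ) (f : (Fin n → ℝ) → ℝ) : Prop :=
  Continuous f ∧ ∀ (c : ℝ), 0 ≤ c → ∀ t : Fin n → ℝ, f (c • t) = c * f t

section Defs

variable {X : Type*} [Lattice X] [AddCommGroup X] [Module ℝ X]

/-- The order ideal `I_e` generated by `e`. -/
def idealSet (e : X) : Set X := {x : X | ∃ c : ℝ, 0 ≤ c ∧ |x| ≤ c • e}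

/-- The norm `‖x‖_e = inf {c ≥ 0 : |x| ≤ c • e}`. -/
noncomputable def regNorm (e x : X) : ℝ := sInf {c : ℝ | 0 ≤ c ∧ |x| ≤ c • e}

/-- The norm `‖·‖_e` is complete on the set `S`: every `‖·‖_e`-Cauchy sequence in `S`
converges, in `‖·‖_e`, to an element of `S`. -/
def NormComplete (e : X) (S : Set X) : Prop :=
  ∀ u : ℕ → X, (∀ k, u k ∈ S) →
    (∀ ε : ℝ, 0 < ε → ∃ N : ℕ, ∀ p q : ℕ, N ≤ p → N ≤ q → regNorm e (u p - u q) < ε) →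
    ∃ x ∈ S, ∀ ε : ℝ, 0 < ε → ∃ N : ℕ, ∀ p : ℕ, N ≤ p → regNorm e (u p - x) < ε

/-- A uniformly complete vector lattice: `(I_e, ‖·‖_e)` is complete for every `e ≥ 0`. -/
def UniformlyComplete (X : Type*) [Lattice X] [AddCommGroup X] [Module ℝ X] : Prop :=
  ∀ e : X, 0 ≤ e → NormComplete e (idealSet e)

/-- A subset `Z` is uniformly complete as a vector lattice in its own right. -/
def UCSet (Z : Set X) : Prop :=
  ∀ e ∈ Z, 0 ≤ e → NormComplete e (Z ∩ idealSet e)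

/-- A (vector) sublattice: a linear subspace closed under binary suprema. -/
def IsSublatticeSet (Z : Set X) : Prop :=
  (0 ∈ Z) ∧ (∀ a ∈ Z, ∀ b ∈ Z, a + b ∈ Z) ∧ (∀ (c : ℝ), ∀ a ∈ Z, c • a ∈ Z) ∧
  (∀ a ∈ Z, -a ∈ Z) ∧ (∀ a ∈ Z, ∀ b ∈ Z, a ⊔ b ∈ Z) ∧ (∀ a ∈ Z, ∀ b ∈ Z, a ⊓ b ∈ Z)

/-- An order ideal: a linear subspace that is solid. -/
def IsOrderIdealSet (I : Set X) : Prop :=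
  (0 ∈ I) ∧ (∀ a ∈ I, ∀ b ∈ I, a + b ∈ I) ∧ (∀ (c : ℝ), ∀ a ∈ I, c • a ∈ I) ∧
  (∀ a ∈ I, ∀ b : X, |b| ≤ |a| → b ∈ I)

/-- A vector lattice homomorphism defined on the class of functions `ℝⁿ → ℝ`
satisfying the predicate `P` (with pointwise operations), taking values in `X`. -/
def IsLatHom {n : ℕ} (P : ((Fin n → ℝ) → ℝ) → Prop) (Φ : ∀ f, P f → X) : Prop :=
  (∀ (f g : (Fin n → ℝ) → ℝ) (hf : P f) (hg : P g) (hfg : P (f + g)),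
      Φ (f + g) hfg = Φ f hf + Φ g hg) ∧
  (∀ (c : ℝ) (f : (Fin n → ℝ) → ℝ) (hf : P f) (hcf : P (c • f)),
      Φ (c • f) hcf = c • Φ f hf) ∧
  (∀ (f g : (Fin n → ℝ) → ℝ) (hf : P f) (hg : P g) (hfg : P (f ⊔ g)),
      Φ (f ⊔ g) hfg = Φ f hf ⊔ Φ g hg)

end Defs

section MulDefs

variable {X : Type*} [Lattice X] [AddCommGroup X] [Module ℝ X] [Mul X]

/-- A lattice-algebra homomorphism defined on the class of functions `ℝⁿ → ℝ`
satisfying the predicate `P` (with pointwise operations), taking values in `X`. -/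
def IsLatAlgHom {n : ℕ} (P : ((Fin n → ℝ) → ℝ) → Prop) (Ψ : ∀ f, P f → X) : Prop :=
  IsLatHom P Ψ ∧
  (∀ (f g : (Fin n → ℝ) → ℝ) (hf : P f) (hg : P g) (hfg : P (f * g)),
      Ψ (f * g) hfg = Ψ f hf * Ψ g hg)

/-- A sublattice-algebra: a linear subspace that is both a sublattice and a subalgebra. -/
def IsSublatticeAlgebraSet (Z : Set X) : Prop :=
  IsSublatticeSet Z ∧ ∀ a ∈ Z, ∀ b ∈ Z, a * b ∈ Z

/-- The `f`-algebra condition, relativized to a subset. -/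
def IsFAlgebraSet (Z : Set X) : Prop :=
  ∀ a ∈ Z, ∀ b ∈ Z, ∀ z ∈ Z, a ⊓ b = 0 → 0 ≤ z → (z * a) ⊓ b = 0 ∧ (a * z) ⊓ b = 0

/-- An `f`-subalgebra: a sublattice-algebra which is itself an `f`-algebra. -/
def IsFSubalgebra (Z : Set X) : Prop := IsSublatticeAlgebraSet Z ∧ IsFAlgebraSet Z

/-- `powS e m = e^(m+1)`, defined without assuming an identity element. -/
def powS (e : X) : ℕ → X
  | 0 => e
  | m + 1 => powS e m * e

end MulDefs

/-- A map `T : X → A` which is a lattice-algebra homomorphism on a subset `S` of `X`. -/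
def IsLatAlgHomOn {X A : Type*} [Lattice X] [AddCommGroup X] [Module ℝ X] [Mul X]
    [Lattice A] [AddCommGroup A] [Module ℝ A] [Mul A] (S : Set X) (T : X → A) : Prop :=
  (∀ a ∈ S, ∀ b ∈ S, T (a + b) = T a + T b) ∧
  (∀ (c : ℝ), ∀ a ∈ S, T (c • a) = c • T a) ∧
  (∀ a ∈ S, ∀ b ∈ S, T (a ⊔ b) = T a ⊔ T b) ∧
  (∀ a ∈ S, ∀ b ∈ S, T (a * b) = T a * T b)

section PolyGrowthClosure

variable {n : ℕ} {f g : (Fin n → ℝ) → ℝ}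

/-- The weight `1 + ∑ |tᵢ|` controlling polynomial growth. -/
def growthWeight (n : ℕ) (t : Fin n → ℝ) : ℝ := 1 + ∑ i : Fin n, |t i|

theorem one_le_growthWeight (t : Fin n → ℝ) : 1 ≤ growthWeight n t :=
  le_add_of_nonneg_right (Finset.sum_nonneg fun _ _ => abs_nonneg _)

theorem norm_le_growthWeight (t : Fin n → ℝ) : ‖t‖ ≤ growthWeight n t := by
  refine (pi_norm_le_iff_of_nonneg (zero_le_one.trans (one_le_growthWeight t))).2 fun i => ?_
  have := Finset.single_le_sum (f := fun i => |t i|) (fun i _ => abs_nonneg _) (Finset.mem_univ i)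
  simp only [growthWeight, Real.norm_eq_abs] at this ⊢
  linarith

theorem continuous_growthWeight : Continuous (growthWeight n) := by
  unfold growthWeight
  fun_prop

theorem polyGrowth_growthWeight : PolyGrowth n (growthWeight n) :=
  ⟨continuous_growthWeight, 1, 1, zero_le_one, fun t => by
    rw [abs_of_nonneg (zero_le_one.trans (one_le_growthWeight t)), pow_one, one_mul,
      growthWeight]⟩

theorem PolyGrowth.of_abs_le_add (hc : Continuous g) {f₁ f₂ : (Fin n → ℝ) → ℝ}
    (h₁ : PolyGrowth n f₁) (h₂ : PolyGrowth n f₂) (h : ∀ t, |g t| ≤ |f₁ t| + |f₂ t|) :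
    PolyGrowth n g := by
  obtain ⟨-, M, N, hM, hf⟩ := h₁
  obtain ⟨-, M', N', hM', hg⟩ := h₂
  refine ⟨hc, M + M', N + N', add_nonneg hM hM', fun t => ?_⟩
  have hw := one_le_growthWeight t
  have e₁ := mul_le_mul_of_nonneg_left (pow_le_pow_right₀ hw (Nat.le_add_right N N')) hM
  have e₂ := mul_le_mul_of_nonneg_left (pow_le_pow_right₀ hw (Nat.le_add_left N' N)) hM'
  have := h t
  have := hf t
  have := hg t
  simp only [growthWeight] at *
  linarith

theorem PolyGrowth.add (hf : PolyGrowth n f) (hg : PolyGrowth n g) : PolyGrowth n (f + g) :=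
  .of_abs_le_add (hf.1.add hg.1) hf hg fun _ => abs_add_le _ _

theorem PolyGrowth.sup (hf : PolyGrowth n f) (hg : PolyGrowth n g) : PolyGrowth n (f ⊔ g) :=
  .of_abs_le_add (hf.1.sup hg.1) hf hg fun _ =>
    abs_max_le_max_abs_abs.trans (max_le_add_of_nonneg (abs_nonneg _) (abs_nonneg _))

theorem PolyGrowth.mul (hf : PolyGrowth n f) (hg : PolyGrowth n g) : PolyGrowth n (f * g) := by
  obtain ⟨hfc, M, N, hM, hf⟩ := hf
  obtain ⟨hgc, M', N', hM', hg⟩ := hg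
  refine ⟨hfc.mul hgc, M * M', N + N', mul_nonneg hM hM', fun t => ?_⟩
  rw [Pi.mul_apply, abs_mul, pow_add, mul_mul_mul_comm]
  exact mul_le_mul (hf t) (hg t) (abs_nonneg _) ((abs_nonneg _).trans (hf t))

theorem polyGrowth_const (c : ℝ) : PolyGrowth n fun _ => c :=
  ⟨continuous_const, |c|, 0, abs_nonneg c, fun _ => by simp⟩

theorem PolyGrowth.smul (c : ℝ) (hf : PolyGrowth n f) : PolyGrowth n (c • f) :=
  (polyGrowth_const c).mul hf

theorem polyGrowth_proj (i : Fin n) : PolyGrowth n fun t => t i :=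
  .of_abs_le_add (continuous_apply i) polyGrowth_growthWeight (polyGrowth_const 0) fun t => by
    have := norm_le_growthWeight t
    have := norm_le_pi_norm t i
    have := le_abs_self (growthWeight n t)
    rw [← Real.norm_eq_abs]
    linarith [abs_nonneg (0 : ℝ)]

end PolyGrowthClosure

section Approximation

variable {n : ℕ}

/-- Weighted Stone–Weierstrass: a subalgebra of `C(ℝⁿ, ℝ)` which is closed under suprema and
contains the coordinates approximates every function bounded by `M * w ^ N` up to `w ^ (N + 1)`,
where `w` is the growth weight. -/
theorem exists_abs_sub_le_growthWeight_pow (A : Subalgebra ℝ C(Fin n → ℝ, ℝ))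
    (hsup : ∀ a ∈ A, ∀ b ∈ A, a ⊔ b ∈ A)
    (hproj : ∀ i : Fin n, (⟨fun t => t i, continuous_apply i⟩ : C(Fin n → ℝ, ℝ)) ∈ A)
    (hweight : (⟨growthWeight n, continuous_growthWeight⟩ : C(Fin n → ℝ, ℝ)) ∈ A)
    (f : C(Fin n → ℝ, ℝ)) {M : ℝ} {N : ℕ}
    (hf : ∀ t, |f t| ≤ M * growthWeight n t ^ N) :
    ∃ p ∈ A, ∀ t, |f t - p t| ≤ growthWeight n t ^ (N + 1) := by
  have hsep : A.SeparatesPoints := by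
    intro s t hst
    obtain ⟨i, hi⟩ := Function.ne_iff.1 hst
    exact ⟨_, ⟨_, hproj i, rfl⟩, hi⟩
  obtain ⟨q, hqA, hq⟩ :=
    ContinuousMap.exists_mem_subalgebra_near_continuous_of_isCompact_of_separatesPoints hsep f
      (isCompact_closedBall (0 : Fin n → ℝ) (2 * M)) zero_lt_one
  set b : C(Fin n → ℝ, ℝ) := M • (⟨growthWeight n, continuous_growthWeight⟩ ^ N)
  have hbA : b ∈ A := A.smul_mem (pow_mem hweight N) M
  have hbt : ∀ t, b t = M * growthWeight n t ^ N := fun t => rfl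
  refine ⟨-(-(q ⊔ -b) ⊔ -b), neg_mem (hsup _ (neg_mem (hsup _ hqA _ (neg_mem hbA))) _
    (neg_mem hbA)), fun t => ?_⟩
  have hw := one_le_growthWeight t
  have hpt : (-(-(q ⊔ -b) ⊔ -b)) t = -max (-max (q t) (-(b t))) (-(b t)) := rfl
  have hfb : |f t| ≤ b t := hf t
  rw [hpt, max_neg_neg, neg_neg]
  by_cases ht : ‖t‖ ≤ 2 * M
  · have h1 : |q t - f t| < 1 := by
      simpa using hq t (by simpa using ht)
    have h2 : (1 : ℝ) ≤ growthWeight n t ^ (N + 1) := one_le_pow₀ hw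
    rw [abs_le] at hfb ⊢
    rw [abs_lt] at h1
    grind
  · have h2 : 2 * b t ≤ growthWeight n t ^ (N + 1) := by
      rw [hbt, pow_succ']
      have := norm_le_growthWeight t
      have h3 : (0 : ℝ) ≤ growthWeight n t ^ N := by positivity
      nlinarith
    rw [abs_le] at hfb ⊢
    grind

end Approximation

section LatHom

variable {X : Type*} [Lattice X] {n : ℕ}

theorem IsLatHom.mono [AddCommGroup X] [Module ℝ X] {P : ((Fin n → ℝ) → ℝ) → Prop}
    {Φ : ∀ f, P f → X} (h : IsLatHom P Φ) {f g : (Fin n → ℝ) → ℝ} (hf : P f) (hg : P g)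
    (hfg : f ≤ g) : Φ f hf ≤ Φ g hg := by
  have e : f ⊔ g = g := sup_eq_right.2 hfg
  have hs : P (f ⊔ g) := e.symm ▸ hg
  have h1 := h.2.2 f g hf hg hs
  have h2 : Φ (f ⊔ g) hs = Φ g hg := by congr
  rw [← h2, h1]
  exact le_sup_left

/-- The continuous functions of polynomial growth on which two unital lattice-algebra
homomorphisms agree. -/
def polyGrowthEqualizer [Ring X] [Module ℝ X] {Ψ₁ Ψ₂ : ∀ f, PolyGrowth n f → X}
    (h₁ : IsLatAlgHom (PolyGrowth n) Ψ₁) (h₂ : IsLatAlgHom (PolyGrowth n) Ψ₂)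
    (hone : ∀ h, Ψ₁ 1 h = Ψ₂ 1 h) : Subalgebra ℝ C(Fin n → ℝ, ℝ) where
  carrier := {f | ∃ hf : PolyGrowth n f, Ψ₁ f hf = Ψ₂ f hf}
  mul_mem' := by
    rintro f g ⟨hf, ef⟩ ⟨hg, eg⟩
    refine ⟨hf.mul hg, (h₁.2 f g hf hg _).trans ?_⟩
    rw [ef, eg]
    exact (h₂.2 f g hf hg _).symm
  add_mem' := by
    rintro f g ⟨hf, ef⟩ ⟨hg, eg⟩
    refine ⟨hf.add hg, (h₁.1.1 f g hf hg _).trans ?_⟩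
    rw [ef, eg]
    exact (h₂.1.1 f g hf hg _).symm
  algebraMap_mem' := by
    intro r
    have e : ⇑(algebraMap ℝ C(Fin n → ℝ, ℝ) r) = r • (1 : (Fin n → ℝ) → ℝ) := by
      ext t
      simp
    have h1 : PolyGrowth n 1 := polyGrowth_const 1
    simp only [Set.mem_ofPred_eq, e]
    refine ⟨h1.smul r, ?_⟩
    rw [h₁.1.2.1 r 1 h1, h₂.1.2.1 r 1 h1, hone]

theorem sup_mem_polyGrowthEqualizer [Ring X] [Module ℝ X] {Ψ₁ Ψ₂ : ∀ f, PolyGrowth n f → X}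
    (h₁ : IsLatAlgHom (PolyGrowth n) Ψ₁) (h₂ : IsLatAlgHom (PolyGrowth n) Ψ₂)
    (hone : ∀ h, Ψ₁ 1 h = Ψ₂ 1 h) {f g : C(Fin n → ℝ, ℝ)}
    (hf : f ∈ polyGrowthEqualizer h₁ h₂ hone) (hg : g ∈ polyGrowthEqualizer h₁ h₂ hone) :
    f ⊔ g ∈ polyGrowthEqualizer h₁ h₂ hone := by
  obtain ⟨hf, ef⟩ := hf
  obtain ⟨hg, eg⟩ := hg
  refine ⟨hf.sup hg, (h₁.1.2.2 f g hf hg _).trans ?_⟩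
  rw [ef, eg]
  exact (h₂.1.2.2 f g hf hg _).symm

theorem IsLatHom.sub_le_two_nsmul [AddCommGroup X] [Module ℝ X]
    [CovariantClass X X (· + ·) (· ≤ ·)] {Φ₁ Φ₂ : ∀ f, PolyGrowth n f → X}
    (h₁ : IsLatHom (PolyGrowth n) Φ₁) (h₂ : IsLatHom (PolyGrowth n) Φ₂)
    {f p w : (Fin n → ℝ) → ℝ} (hf : PolyGrowth n f) (hp : PolyGrowth n p) (hw : PolyGrowth n w)
    (hfp : ∀ t, |f t - p t| ≤ w t) (ep : Φ₁ p hp = Φ₂ p hp) (ew : Φ₁ w hw = Φ₂ w hw) :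
    Φ₁ f hf - Φ₂ f hf ≤ 2 • Φ₁ w hw := by
  have u : Φ₁ f hf ≤ Φ₁ p hp + Φ₁ w hw := by
    rw [← h₁.1 p w hp hw (hp.add hw)]
    exact h₁.mono _ _ fun t => by linarith [(abs_le.1 (hfp t)).2, Pi.add_apply p w t]
  have l : Φ₂ p hp ≤ Φ₂ f hf + Φ₂ w hw := by
    rw [← h₂.1 f w hf hw (hf.add hw)]
    exact h₂.mono _ _ fun t => by linarith [(abs_le.1 (hfp t)).1, Pi.add_apply f w t]
  calc Φ₁ f hf - Φ₂ f hf ≤ Φ₁ p hp + Φ₁ w hw - Φ₂ f hf := by gcongr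
    _ = Φ₂ p hp + (Φ₁ w hw - Φ₂ f hf) := by rw [ep, add_sub_assoc]
    _ ≤ Φ₂ f hf + Φ₂ w hw + (Φ₁ w hw - Φ₂ f hf) := by gcongr
    _ = 2 • Φ₁ w hw := by rw [ew]; abel

end LatHom

/-- uniqueness of the polynomial growth continuous function calculus. -/
theorem stmt_1 {X : Type*} [Lattice X] [Ring X] [Module ℝ X]
    [CovariantClass X X (· + ·) (· ≤ ·)] [IsScalarTower ℝ X X] [SMulCommClass ℝ X X]
    (hsmulpos : ∀ (c : ℝ) (y : X), 0 ≤ c → 0 ≤ y → 0 ≤ c • y)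
    (hmulpos : ∀ y z : X, 0 ≤ y → 0 ≤ z → 0 ≤ y * z)
    (harch : ∀ y z : X, 0 ≤ y → 0 ≤ z → (∀ k : ℕ, k • y ≤ z) → y = 0)
    (n : ℕ) (x : Fin n → X)
    (Ψ₁ Ψ₂ : ∀ f : (Fin n → ℝ) → ℝ, PolyGrowth n f → X)
    (h₁ : IsLatAlgHom (PolyGrowth n) Ψ₁) (h₂ : IsLatAlgHom (PolyGrowth n) Ψ₂)
    (h₁one : ∀ h1 : PolyGrowth n 1, Ψ₁ 1 h1 = 1)
    (h₂one : ∀ h1 : PolyGrowth n 1, Ψ₂ 1 h1 = 1)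
    (h₁proj : ∀ (i : Fin n) (hi : PolyGrowth n fun t => t i), Ψ₁ (fun t => t i) hi = x i)
    (h₂proj : ∀ (i : Fin n) (hi : PolyGrowth n fun t => t i), Ψ₂ (fun t => t i) hi = x i) :
    ∀ (f : (Fin n → ℝ) → ℝ) (hf : PolyGrowth n f), Ψ₁ f hf = Ψ₂ f hf := by
  intro f hf
  have hone : ∀ h, Ψ₁ 1 h = Ψ₂ 1 h := fun h => (h₁one h).trans (h₂one h).symm
  set A := polyGrowthEqualizer h₁ h₂ hone
  have hsup : ∀ a ∈ A, ∀ b ∈ A, a ⊔ b ∈ A := fun a ha b hb =>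
    sup_mem_polyGrowthEqualizer h₁ h₂ hone ha hb
  have hproj : ∀ i : Fin n, (⟨fun t => t i, continuous_apply i⟩ : C(Fin n → ℝ, ℝ)) ∈ A := fun i =>
    ⟨polyGrowth_proj i, (h₁proj i _).trans (h₂proj i _).symm⟩
  have hweight : (⟨growthWeight n, continuous_growthWeight⟩ : C(Fin n → ℝ, ℝ)) ∈ A := by
    have e : (⟨growthWeight n, continuous_growthWeight⟩ : C(Fin n → ℝ, ℝ)) =
        1 + ∑ i : Fin n, ((⟨fun t => t i, continuous_apply i⟩ : C(Fin n → ℝ, ℝ)) ⊔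
          -⟨fun t => t i, continuous_apply i⟩) := by
      ext t
      simp [growthWeight, abs]
    rw [e]
    exact add_mem (one_mem A) (sum_mem fun i _ => hsup _ (hproj i) _ (neg_mem (hproj i)))
  obtain ⟨-, M, N, -, hfM⟩ := id hf
  obtain ⟨hW, eW⟩ : (⟨growthWeight n, continuous_growthWeight⟩ : C(Fin n → ℝ, ℝ)) ^ (N + 1) ∈ A :=
    pow_mem hweight _
  set W := Ψ₁ _ hW
  set d := Ψ₁ f hf - Ψ₂ f hf
  have bound : ∀ c : ℝ, c • d ≤ 2 • W := by
    intro c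
    obtain ⟨p, ⟨hp, ep⟩, hpb⟩ := exists_abs_sub_le_growthWeight_pow A hsup hproj hweight
      ⟨c • f, (hf.smul c).1⟩ (M := |c| * M) (N := N) fun t => by
        simpa [abs_mul, mul_assoc, growthWeight] using mul_le_mul_of_nonneg_left (hfM t) (abs_nonneg c)
    have := h₁.1.sub_le_two_nsmul h₂.1 (hf.smul c) hp hW hpb ep eW
    rwa [h₁.1.2.1 c f hf, h₂.1.2.1 c f hf, ← smul_sub] at this
  have h0 : 0 ≤ 2 • W := by simpa using bound 0
  have hd0 : |d| = 0 := by
    refine harch _ (2 • W) (abs_nonneg d) h0 fun k => ?_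
    rcases Nat.eq_zero_or_pos k with rfl | hk
    · simpa using h0
    have hsmul : ∀ c : ℝ, 0 ≤ c → ∀ y z : X, y ≤ z → c • y ≤ c • z := fun c hc y z hyz => by
      rw [← sub_nonneg, ← smul_sub]
      exact hsmulpos c _ hc (sub_nonneg.2 hyz)
    have hk' : (k : ℝ) ≠ 0 := by positivity
    have half : ∀ y : X, (k : ℝ) • y ≤ 2 • W → y ≤ (k : ℝ)⁻¹ • (2 • W) := fun y hy => by
      simpa [smul_smul, hk'] using hsmul (k : ℝ)⁻¹ (by positivity) _ _ hy
    have habs : |d| ≤ (k : ℝ)⁻¹ • (2 • W) :=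
      sup_le (half _ (bound k)) (half _ (by simpa using bound (-k)))
    rw [← Nat.cast_smul_eq_nsmul ℝ]
    simpa only [smul_inv_smul₀ hk'] using hsmul k (by positivity) _ _ habs
  exact sub_eq_zero.1 (le_antisymm (hd0 ▸ le_abs_self d) (neg_nonpos.1 (hd0 ▸ neg_le_abs d)))
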